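/- arXiv:1710.00234 — 5 statements merged into one kernel-verified Lean document; each statement's English description precedes it below -/
import Mathlib

section
/- Let A and B be finite structures over a finite relational signature σ, and let STR*[σ] be a fixed set containing exactly one structure from each isomorphism class of finite σ-structures. Then Surjhom(A,B) = Σ_{B' ∈ STR*[σ]} Condens(A,B') · Deducts(B',B), where all but finitely many terms of the sum are zero. -/
/-- A finite relational signature: a finite set of relation symbols with arities. -/
structure Sig where
  symb : Type
  [fin : Finite symb]
  ar : symb → ℕ

attribute [instance] Sig.fin

/-- A finite structure over the signature `σ`. -/
structure Str (σ : Sig) where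
  carrier : Type
  [fin : Finite carrier]
  rel : ∀ R : σ.symb, Set (Fin (σ.ar R) → carrier)

attribute [instance] Str.fin

variable {σ : Sig}

/-- `h` is a homomorphism from `A` to `B`. -/
def IsHom (A B : Str σ) (h : A.carrier → B.carrier) : Prop :=
  ∀ R : σ.symb, ∀ t ∈ A.rel R, (h ∘ t) ∈ B.rel R

/-- `h` is a surjective homomorphism from `A` to `B`. -/
def IsSurjHom (A B : Str σ) (h : A.carrier → B.carrier) : Prop :=
  IsHom A B h ∧ Function.Surjective h

/-- `h` is a condensation from `A` to `B`. -/
def IsCondens (A B : Str σ) (h : A.carrier → B.carrier) : Prop :=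
  IsSurjHom A B h ∧ ∀ R : σ.symb, (fun t => h ∘ t) '' A.rel R = B.rel R

/-- The number of homomorphisms from `A` to `B`. -/
noncomputable def homCount (A B : Str σ) : ℕ := Nat.card {h : A.carrier → B.carrier // IsHom A B h}

/-- The number of surjective homomorphisms from `A` to `B`. -/
noncomputable def surjHomCount (A B : Str σ) : ℕ :=
  Nat.card {h : A.carrier → B.carrier // IsSurjHom A B h}

/-- The number of condensations from `A` to `B`. -/
noncomputable def condensCount (A B : Str σ) : ℕ :=
  Nat.card {h : A.carrier → B.carrier // IsCondens A B h}

/-- Isomorphism of structures. -/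
def Iso (A B : Str σ) : Prop :=
  ∃ e : A.carrier ≃ B.carrier, ∀ (R : σ.symb) (t : Fin (σ.ar R) → A.carrier),
    t ∈ A.rel R ↔ (⇑e ∘ t) ∈ B.rel R

/-- Homomorphic equivalence of structures. -/
def HomEquiv (A B : Str σ) : Prop :=
  (∃ h, IsHom A B h) ∧ (∃ h, IsHom B A h)

/-- The induced substructure of `B` on the subset `S`. -/
def induced (B : Str σ) (S : Set B.carrier) : Str σ where
  carrier := S
  rel R := {t | (fun i => (t i).val) ∈ B.rel R}

/-- The number of subsets `S` of the universe of `B` with `B[S]` isomorphic to `B'`. -/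
noncomputable def indsubCount (B' B : Str σ) : ℕ :=
  Nat.card {S : Set B.carrier // Iso (induced B S) B'}

/-- The deduct of `B` given by a family of subrelations `r`. -/
def deduct (B : Str σ) (r : ∀ R : σ.symb, Set (Fin (σ.ar R) → B.carrier)) : Str σ where
  carrier := B.carrier
  rel := r

/-- `C` is a deduct of `B`. -/
def IsDeductOf (C B : Str σ) : Prop :=
  ∃ r : ∀ R : σ.symb, Set (Fin (σ.ar R) → B.carrier),
    (∀ R, r R ⊆ B.rel R) ∧ C = deduct B r

/-- The number of deducts of `B` isomorphic to `B'`. -/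
noncomputable def deductsCount (B' B : Str σ) : ℕ :=
  Nat.card {r : ∀ R : σ.symb, Set (Fin (σ.ar R) → B.carrier) //
    (∀ R, r R ⊆ B.rel R) ∧ Iso (deduct B r) B'}

/-- The disjoint union of two structures. -/
def disjUnion (A₁ A₂ : Str σ) : Str σ where
  carrier := A₁.carrier ⊕ A₂.carrier
  rel R := (fun t => Sum.inl ∘ t) '' A₁.rel R ∪ (fun t => Sum.inr ∘ t) '' A₂.rel R

/-- The `N`-fold disjoint union of `A` with itself. -/
def nCopies (N : ℕ) (A : Str σ) : Str σ where
  carrier := Fin N × A.carrier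
  rel R := {t | ∃ j : Fin N, ∃ s ∈ A.rel R, t = fun i => (j, s i)}

/-- The total size of a structure: universe size plus sizes of all relations. -/
noncomputable def totalSize (B : Str σ) : ℕ :=
  Nat.card B.carrier + ∑ᶠ R : σ.symb, (B.rel R).ncard

/-- Condensations onto isomorphic structures are equinumerous. -/
theorem condensCount_eq_of_iso (A : Str σ) {C D : Str σ} (h : Iso C D) :
    condensCount A C = condensCount A D := by
  obtain ⟨e, he⟩ := h
  refine Nat.card_congr ((Equiv.arrowCongr (Equiv.refl _) e).subtypeEquiv fun f => ?_)
  have hef : (Equiv.arrowCongr (Equiv.refl A.carrier) e) f = e ∘ f := rfl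
  rw [hef]
  unfold IsCondens IsSurjHom IsHom
  refine and_congr (and_congr ?_ ?_) ?_
  · exact forall_congr' fun R => forall₂_congr fun t _ => he R (f ∘ t)
  · exact (e.comp_surjective f).symm
  · refine forall_congr' fun R => ?_
    have himage : (fun t : Fin (σ.ar R) → A.carrier => (e ∘ f) ∘ t) '' A.rel R =
        (fun t => e ∘ t) '' ((fun t => f ∘ t) '' A.rel R) := by
      rw [Set.image_image]; rfl
    have hrel : D.rel R = (fun t => e ∘ t) '' C.rel R := by
      ext t
      constructor
      · intro ht
        have hcancel : e ∘ (e.symm ∘ t) = t := by ext i; simp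
        exact ⟨e.symm ∘ t, (he R _).2 (by rwa [hcancel]), hcancel⟩
      · rintro ⟨s, hs, rfl⟩
        exact (he R s).1 hs
    rw [himage, hrel]
    exact (Set.image_injective.2 e.injective.comp_left).eq_iff.symm

/-- A surjective homomorphism onto `B` is the same as a condensation onto a unique deduct of `B`. -/
def surjHomEquivSigma (A B : Str σ) :
    {h : A.carrier → B.carrier // IsSurjHom A B h} ≃
      Σ d : {r : ∀ R : σ.symb, Set (Fin (σ.ar R) → B.carrier) // ∀ R, r R ⊆ B.rel R},
        {h : A.carrier → (deduct B d.1).carrier // IsCondens A (deduct B d.1) h} where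
  toFun h :=
    ⟨⟨fun R => (fun t => h.1 ∘ t) '' A.rel R, by
        rintro R _ ⟨t, ht, rfl⟩
        exact h.2.1 R t ht⟩,
      ⟨h.1, ⟨fun _ t ht => ⟨t, ht, rfl⟩, h.2.2⟩, fun _ => rfl⟩⟩
  invFun p := ⟨p.2.1, fun R t ht => p.1.2 R (p.2.2.1.1 R t ht), p.2.2.1.2⟩
  left_inv _ := rfl
  right_inv := by
    rintro ⟨⟨r, hr⟩, h, hh⟩
    change A.carrier → B.carrier at h
    obtain rfl : (fun R => (fun t => h ∘ t) '' A.rel R) = r := funext hh.2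
    rfl

/-- Surjhom(A,B) = Σ_{B' ∈ STR*[σ]} Condens(A,B') · Deducts(B',B),
with all but finitely many terms zero. -/
theorem stmt_2 (σ : Sig) (Rep : Set (Str σ))
    (hRep : ∀ C : Str σ, ∃! C', C' ∈ Rep ∧ Iso C C')
    (A B : Str σ) :
    {B' ∈ Rep | condensCount A B' * deductsCount B' B ≠ 0}.Finite ∧
    surjHomCount A B = ∑ᶠ B' ∈ Rep, condensCount A B' * deductsCount B' B := by
  classical
  choose rep hrep huniq using hRep
  let D := {r : ∀ R : σ.symb, Set (Fin (σ.ar R) → B.carrier) // ∀ R, r R ⊆ B.rel R}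
  have : Fintype D := Fintype.ofFinite D
  let g : D → Str σ := fun d => rep (deduct B d.1)
  have hcount : ∀ B' ∈ Rep, deductsCount B' B = (Finset.univ.filter fun d => g d = B').card := by
    intro B' hB'
    rw [← Fintype.card_subtype, ← Nat.card_eq_fintype_card]
    refine Nat.card_congr ((Equiv.subtypeSubtypeEquivSubtypeInter _ _).symm.trans
      (Equiv.subtypeEquivRight fun d => ⟨fun h => ?_, fun h => ?_⟩))
    · exact (huniq _ B' ⟨hB', h⟩).symm
    · exact h ▸ (hrep (deduct B d.1)).2
  have hsub : {B' ∈ Rep | condensCount A B' * deductsCount B' B ≠ 0} ⊆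
      (Finset.univ.image g : Finset (Str σ)) := by
    rintro B' ⟨hB', hne⟩
    rw [hcount B' hB'] at hne
    obtain ⟨d, hd⟩ := Finset.card_ne_zero.1 (right_ne_zero_of_mul hne)
    exact Finset.mem_coe.2 (Finset.mem_image.2 ⟨d, Finset.mem_univ d, (Finset.mem_filter.1 hd).2⟩)
  have hmem : ∀ B' ∈ Finset.univ.image g, B' ∈ Rep := by
    intro B' h
    obtain ⟨d, -, rfl⟩ := Finset.mem_image.1 h
    exact (hrep _).1
  refine ⟨(Finset.finite_toSet _).subset hsub, ?_⟩
  rw [finsum_mem_eq_sum_of_inter_support_eq (t := Finset.univ.image g)]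
  · calc surjHomCount A B = ∑ d : D, condensCount A (deduct B d.1) := by
          rw [surjHomCount, Nat.card_congr (surjHomEquivSigma A B), Nat.card_sigma]
          rfl
      _ = ∑ d : D, condensCount A (g d) :=
          Finset.sum_congr rfl fun d _ => condensCount_eq_of_iso A (hrep _).2
      _ = _ := by
          rw [Finset.sum_comp (condensCount A) g]
          refine Finset.sum_congr rfl fun B' hB' => ?_
          rw [hcount B' (hmem B' hB'), smul_eq_mul, mul_comm]
  · ext B'
    exact ⟨fun h => ⟨hsub ⟨h.1, h.2⟩, h.2⟩, fun h => ⟨hmem B' h.1, h.2⟩⟩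
end

section
/- Let A and B be finite structures over a finite relational signature σ, and let STR*[σ] be a fixed set containing exactly one structure from each isomorphism class of finite σ-structures. Then Condens(A,B) = Surjhom(A,B) − Σ_{B' ∈ STR*[σ], |B'| = |B|, ||B'|| < ||B||} Condens(A,B') · Deducts(B',B), where all but finitely many terms of the sum are zero. -/
variable {σ : Sig}

theorem Iso.condensCount_eq {σ : Sig} (A : Str σ) {C D : Str σ} (h : Iso C D) :
    condensCount A C = condensCount A D := by
  obtain ⟨e, he⟩ := h
  refine Nat.card_congr (Equiv.subtypeEquiv (Equiv.arrowCongr (Equiv.refl _) e) fun g => ?_)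
  have hcoe : (Equiv.arrowCongr (Equiv.refl _) e) g = e ∘ g := rfl
  have himage : ∀ R, (fun t => (e ∘ g) ∘ t) '' A.rel R =
      (fun t : Fin (σ.ar R) → C.carrier => e ∘ t) '' ((fun t => g ∘ t) '' A.rel R) := fun R => by
    rw [Set.image_image]; rfl
  have hrel : ∀ R, D.rel R = (fun t : Fin (σ.ar R) → C.carrier => e ∘ t) '' C.rel R := by
    intro R
    ext t
    constructor
    · intro ht
      have hcomp : e ∘ (e.symm ∘ t) = t := by ext; simp
      exact ⟨e.symm ∘ t, (he R _).2 (by rwa [hcomp]), hcomp⟩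
    · rintro ⟨s, hs, rfl⟩
      exact (he R s).1 hs
  have hinj : ∀ R, Function.Injective (fun t : Fin (σ.ar R) → C.carrier => e ∘ t) :=
    fun R => e.injective.comp_left
  rw [hcoe]
  unfold IsCondens IsSurjHom IsHom
  refine and_congr (and_congr ?_ ?_) (forall_congr' fun R => ?_)
  · exact forall₃_congr fun R t _ => he R (g ∘ t)
  · exact (e.comp_surjective g).symm
  · rw [himage, hrel, (hinj R).image_injective.eq_iff]

theorem Iso.card_carrier_eq {σ : Sig} {C D : Str σ} (h : Iso C D) :
    Nat.card C.carrier = Nat.card D.carrier :=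
  Nat.card_congr h.choose

theorem Iso.totalSize_eq {σ : Sig} {C D : Str σ} (h : Iso C D) : totalSize C = totalSize D := by
  unfold totalSize
  rw [h.card_carrier_eq]
  obtain ⟨e, he⟩ := h
  congr 1
  refine finsum_congr fun R => ?_
  exact Nat.card_congr (Equiv.subtypeEquiv (Equiv.arrowCongr (Equiv.refl _) e) fun t => he R t)

theorem totalSize_deduct_lt {σ : Sig} (B : Str σ)
    {r : ∀ R : σ.symb, Set (Fin (σ.ar R) → B.carrier)} (hr : r < B.rel) :
    totalSize (deduct B r) < totalSize B := by
  have := Fintype.ofFinite σ.symb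
  obtain ⟨hle, R, hR⟩ := Pi.lt_def.1 hr
  unfold totalSize
  rw [finsum_eq_sum_of_fintype, finsum_eq_sum_of_fintype]
  exact Nat.add_lt_add_left (Finset.sum_lt_sum
    (fun S _ => Set.ncard_le_ncard (hle S) (Set.toFinite _))
    ⟨R, Finset.mem_univ _, Set.ncard_lt_ncard hR (Set.toFinite _)⟩) _

theorem isCondens_deduct_iff {σ : Sig} (A B : Str σ)
    (r : ∀ R : σ.symb, Set (Fin (σ.ar R) → B.carrier)) (h : A.carrier → B.carrier) :
    IsCondens A (deduct B r) h ↔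
      Function.Surjective h ∧ (fun R => (fun t => h ∘ t) '' A.rel R) = r := by
  constructor
  · rintro ⟨⟨_, hs⟩, hi⟩
    exact ⟨hs, funext hi⟩
  · rintro ⟨hs, rfl⟩
    exact ⟨⟨fun R t ht => ⟨t, ht, rfl⟩, hs⟩, fun R => rfl⟩

/-- Every surjective homomorphism is a condensation onto exactly one deduct, its image. -/
theorem surjHomCount_eq_sum_condensCount {σ : Sig} (A B : Str σ)
    [Fintype {r : ∀ R : σ.symb, Set (Fin (σ.ar R) → B.carrier) // r ≤ B.rel}] :
    surjHomCount A B =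
      ∑ r : {r : ∀ R : σ.symb, Set (Fin (σ.ar R) → B.carrier) // r ≤ B.rel},
        condensCount A (deduct B r) := by
  unfold condensCount
  rw [← Nat.card_sigma]
  exact Nat.card_congr
    { toFun := fun h => ⟨⟨fun R => (fun t => h.1 ∘ t) '' A.rel R, by
          rintro R _ ⟨t, ht, rfl⟩
          exact h.2.1 R t ht⟩,
        h.1, (isCondens_deduct_iff A B _ _).2 ⟨h.2.2, rfl⟩⟩
      invFun := fun p => ⟨p.2.1, fun R t ht => p.1.2 R (p.2.2.1.1 R t ht), p.2.2.1.2⟩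
      left_inv := fun h => rfl
      right_inv := by
        rintro ⟨⟨r, hr⟩, (h : A.carrier → B.carrier), hh⟩
        obtain ⟨_, rfl⟩ := (isCondens_deduct_iff A B r h).1 hh
        rfl }

/-- Condens(A,B) = Surjhom(A,B) −
Σ_{B' ∈ STR*[σ], |B'| = |B|, ||B'|| < ||B||} Condens(A,B') · Deducts(B',B),
with all but finitely many terms zero. -/
theorem stmt_5 (σ : Sig) (Rep : Set (Str σ))
    (hRep : ∀ C : Str σ, ∃! C', C' ∈ Rep ∧ Iso C C')
    (A B : Str σ) :
    {B' ∈ Rep | Nat.card B'.carrier = Nat.card B.carrier ∧ totalSize B' < totalSize B ∧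
        condensCount A B' * deductsCount B' B ≠ 0}.Finite ∧
    (condensCount A B : ℤ) = (surjHomCount A B : ℤ) -
      ∑ᶠ B' ∈ {B' ∈ Rep | Nat.card B'.carrier = Nat.card B.carrier ∧ totalSize B' < totalSize B},
        (condensCount A B' * deductsCount B' B : ℤ) := by
  classical
  let Sub := {r : ∀ R : σ.symb, Set (Fin (σ.ar R) → B.carrier) // r ≤ B.rel}
  have : Fintype Sub := Fintype.ofFinite _
  choose rep hrep hunique using hRep
  let top : Sub := ⟨B.rel, le_rfl⟩
  let f : Sub → Str σ := fun r => rep (deduct B r)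
  have hf_iff (r : Sub) {B' : Str σ} (hB' : B' ∈ Rep) : Iso (deduct B r) B' ↔ f r = B' :=
    ⟨fun h => (hunique _ B' ⟨hB', h⟩).symm, fun h => h ▸ (hrep _).2⟩
  let proper : Finset Sub := Finset.univ.erase top
  have hf_size (r : Sub) (hr : r ∈ proper) : totalSize (f r) < totalSize B := by
    have hne : r.1 ≠ B.rel := fun h => Finset.ne_of_mem_erase hr (Subtype.ext h)
    exact (hrep _).2.totalSize_eq ▸ totalSize_deduct_lt B (lt_of_le_of_ne r.2 hne)
  have hdeducts {B' : Str σ} (hB' : B' ∈ Rep) (hsize : totalSize B' < totalSize B) :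
      deductsCount B' B = (proper.filter fun r => f r = B').card := by
    have hcount : deductsCount B' B = Nat.card {r : Sub // f r = B'} :=
      Nat.card_congr ((Equiv.subtypeSubtypeEquivSubtypeInter _ _).symm.trans
        (Equiv.subtypeEquivRight fun r => hf_iff r hB'))
    rw [hcount, Nat.card_eq_fintype_card, Fintype.card_subtype]
    congr 1
    ext r
    simp only [proper, Finset.mem_filter, Finset.mem_univ, Finset.mem_erase, true_and, and_true]
    refine ⟨fun h => ⟨?_, h⟩, fun h => h.2⟩
    rintro rfl
    exact hsize.ne (((hf_iff top hB').2 h).totalSize_eq.symm)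
  have hmem_image {B' : Str σ} (hB' : B' ∈ Rep) (hsize : totalSize B' < totalSize B)
      (hne : deductsCount B' B ≠ 0) : B' ∈ proper.image f := by
    rw [hdeducts hB' hsize, Finset.card_ne_zero] at hne
    obtain ⟨r, hr⟩ := hne
    exact Finset.mem_image.2 ⟨r, Finset.mem_filter.1 hr⟩
  refine ⟨(proper.image f).finite_toSet.subset ?_, ?_⟩
  · rintro B' ⟨hB', -, hsize, hne⟩
    exact hmem_image hB' hsize (right_ne_zero_of_mul hne)
  have hsum : ∑ᶠ B' ∈ {B' ∈ Rep | Nat.card B'.carrier = Nat.card B.carrier ∧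
        totalSize B' < totalSize B}, (condensCount A B' * deductsCount B' B : ℤ) =
      ∑ B' ∈ proper.image f, (condensCount A B' * deductsCount B' B : ℤ) := by
    refine finsum_mem_eq_sum_of_inter_support_eq _ (Set.Subset.antisymm ?_ ?_)
    · rintro B' ⟨⟨hB', -, hsize⟩, hne⟩
      refine ⟨hmem_image hB' hsize ?_, hne⟩
      exact_mod_cast right_ne_zero_of_mul hne
    · rintro B' ⟨hB', hne⟩
      obtain ⟨r, hr, rfl⟩ := Finset.mem_image.1 (Finset.mem_coe.1 hB')
      exact ⟨⟨(hrep _).1, (hrep _).2.card_carrier_eq.symm, hf_size r hr⟩, hne⟩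
  have hproper : ∑ r ∈ proper, (condensCount A (deduct B r) : ℤ) =
      ∑ B' ∈ proper.image f, (condensCount A B' * deductsCount B' B : ℤ) := by
    calc ∑ r ∈ proper, (condensCount A (deduct B r) : ℤ)
        = ∑ r ∈ proper, (condensCount A (f r) : ℤ) :=
          Finset.sum_congr rfl fun r _ => by rw [(hrep (deduct B r)).2.condensCount_eq A]
      _ = _ := by
          rw [Finset.sum_comp (fun C => (condensCount A C : ℤ)) f]
          refine Finset.sum_congr rfl fun B' hB' => ?_
          obtain ⟨r, hr, rfl⟩ := Finset.mem_image.1 hB'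
          rw [hdeducts (hrep _).1 (hf_size r hr), nsmul_eq_mul, mul_comm]
  have htotal : (surjHomCount A B : ℤ) =
      condensCount A B + ∑ r ∈ proper, (condensCount A (deduct B r) : ℤ) := by
    rw [surjHomCount_eq_sum_condensCount, ← Finset.add_sum_erase _ _ (Finset.mem_univ top)]
    push_cast
    rfl
  rw [hsum, ← hproper, htotal]
  ring
end

section
/- For every finite structure B over a finite relational signature σ, there exist k ≥ 1, nonzero rational numbers β₁,…,β_k, and pairwise non-isomorphic finite σ-structures B₁,…,B_k such that for every finite σ-structure A, Surjhom(A,B) = β₁ · hom(A,B₁) + ⋯ + β_k · hom(A,B_k). -/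
variable {σ : Sig}

theorem Iso.refl (A : Str σ) : Iso A A :=
  ⟨Equiv.refl _, fun _ _ => Iff.rfl⟩

theorem Iso.symm {A B : Str σ} (h : Iso A B) : Iso B A := by
  obtain ⟨e, he⟩ := h
  refine ⟨e.symm, fun R t => ?_⟩
  rw [he, ← Function.comp_assoc, e.self_comp_symm, Function.id_comp]

theorem Iso.trans {A B C : Str σ} (h : Iso A B) (h' : Iso B C) : Iso A C := by
  obtain ⟨e, he⟩ := h
  obtain ⟨f, hf⟩ := h'
  exact ⟨e.trans f, fun R t => (he R t).trans (hf R _)⟩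

theorem homCount_congr_right (A : Str σ) {B C : Str σ} (h : Iso B C) :
    homCount A B = homCount A C := by
  obtain ⟨e, he⟩ := h
  refine Nat.card_congr (((Equiv.refl A.carrier).arrowCongr e).subtypeEquiv fun f => ?_)
  exact forall_congr' fun R => forall₂_congr fun t _ => he R (f ∘ t)

/-- Homomorphisms into an induced substructure are the homomorphisms whose values lie in the
chosen subset. -/
theorem homCount_induced (A B : Str σ) (S : Set B.carrier) :
    homCount A (induced B S) =
      Nat.card {h : A.carrier → B.carrier // IsHom A B h ∧ ∀ a, h a ∈ S} :=
  Nat.card_congr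
    { toFun := fun h => ⟨fun a => (h.1 a).1, h.2, fun a => (h.1 a).2⟩
      invFun := fun h => ⟨fun a => ⟨h.1 a, h.2.2 a⟩, h.2.1⟩
      left_inv := fun _ => rfl
      right_inv := fun _ => rfl }

/-- Inclusion–exclusion over the set of avoided points of the target. -/
theorem surjHomCount_eq_sum_homCount_induced (A B : Str σ) [Fintype B.carrier] :
    (surjHomCount A B : ℚ) =
      ∑ U : Finset B.carrier, (-1) ^ U.card * (homCount A (induced B (↑U)ᶜ) : ℚ) := by
  classical
  have := Fintype.ofFinite A.carrier
  simp only [homCount_induced, surjHomCount, IsSurjHom, Nat.card_eq_fintype_card,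
    Fintype.card_subtype, Finset.natCast_card_filter, Finset.mul_sum]
  rw [Finset.sum_comm]
  refine Finset.sum_congr rfl fun h _ => ?_
  by_cases hh : IsHom A B h
  · have key := Finset.sum_powerset_neg_one_pow_card (x := (Finset.univ.image h)ᶜ)
    have hsurj : (Finset.univ.image h)ᶜ = ∅ ↔ Function.Surjective h := by
      simp [Finset.eq_univ_iff_forall, Function.Surjective]
    have hmem (U : Finset B.carrier) :
        U ∈ (Finset.univ.image h)ᶜ.powerset ↔ ∀ a, h a ∈ (↑U : Set B.carrier)ᶜ := by
      rw [Finset.mem_powerset, Finset.subset_compl_comm]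
      simp [Finset.subset_iff]
    simp only [hh, true_and, mul_ite, mul_one, mul_zero, ← hmem, ← hsurj]
    rw [← Finset.sum_filter, Finset.filter_univ_mem]
    exact_mod_cast key.symm
  · simp [hh]

/-- Isomorphic targets in a linear combination of homomorphism counts can be merged and vanishing
coefficients dropped. -/
theorem exists_nonIso_linearCombination {ι : Type*} [Fintype ι] (c : ι → ℚ) (C : ι → Str σ) :
    ∃ (k : ℕ) (β : Fin k → ℚ) (Bs : Fin k → Str σ),
      (∀ i, β i ≠ 0) ∧ (∀ i j, i ≠ j → ¬ Iso (Bs i) (Bs j)) ∧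
      ∀ A : Str σ, ∑ i, c i * (homCount A (C i) : ℚ) = ∑ i, β i * (homCount A (Bs i) : ℚ) := by
  classical
  let s : Setoid ι := ⟨fun i j => Iso (C i) (C j), fun _ => Iso.refl _, Iso.symm, Iso.trans⟩
  let d : Quotient s → ℚ := fun q => ∑ i with (⟦i⟧ : Quotient s) = q, c i
  let e := (Fintype.equivFin {q : Quotient s // d q ≠ 0}).symm
  refine ⟨_, fun i => d (e i).1, fun i => C (e i).1.out, fun i => (e i).2, ?_, fun A => ?_⟩
  · intro i j hij hiso
    exact hij (e.injective (Subtype.ext (Quotient.out_equiv_out.mp hiso)))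
  · rw [e.sum_comp (fun q => d q.1 * (homCount A (C q.1.out) : ℚ)),
      ← Finset.sum_fiberwise _ (fun i => (⟦i⟧ : Quotient s))]
    have hfiber (q : Quotient s) :
        ∑ i with (⟦i⟧ : Quotient s) = q, c i * (homCount A (C i) : ℚ) =
          d q * (homCount A (C q.out) : ℚ) := by
      rw [Finset.sum_mul]
      refine Finset.sum_congr rfl fun i hi => ?_
      obtain rfl := (Finset.mem_filter.mp hi).2
      rw [homCount_congr_right A (show Iso (C _) (C i) from Quotient.mk_out i)]
    simp only [hfiber]
    rw [← Finset.sum_subtype (Finset.univ.filter fun q => d q ≠ 0) (by simp)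
      (fun q => d q * (homCount A (C q.out) : ℚ))]
    exact (Finset.sum_filter_of_ne fun q _ hq => left_ne_zero_of_mul hq).symm

theorem surjHomCount_self_ne_zero (B : Str σ) : surjHomCount B B ≠ 0 := by
  have : Nonempty {h : B.carrier → B.carrier // IsSurjHom B B h} :=
    ⟨id, fun _ _ ht => ht, Function.surjective_id⟩
  exact Nat.card_ne_zero.mpr ⟨this, inferInstance⟩

/-- Surjhom(·,B) is a linear combination of homomorphism-counting functions. -/
theorem stmt_6 (σ : Sig) (B : Str σ) :
    ∃ (k : ℕ) (β : Fin k → ℚ) (Bs : Fin k → Str σ),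
      1 ≤ k ∧ (∀ i, β i ≠ 0) ∧ (∀ i j, i ≠ j → ¬ Iso (Bs i) (Bs j)) ∧
      ∀ A : Str σ, (surjHomCount A B : ℚ) = ∑ i, β i * (homCount A (Bs i) : ℚ) := by
  have := Fintype.ofFinite B.carrier
  obtain ⟨k, β, Bs, hβ, hBs, hsum⟩ := exists_nonIso_linearCombination
    (fun U : Finset B.carrier => (-1) ^ U.card) (fun U => induced B (↑U)ᶜ)
  have hsurj (A : Str σ) : (surjHomCount A B : ℚ) = ∑ i, β i * (homCount A (Bs i) : ℚ) :=
    (surjHomCount_eq_sum_homCount_induced A B).trans (hsum A)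
  refine ⟨k, β, Bs, Nat.one_le_iff_ne_zero.mpr ?_, hβ, hBs, hsurj⟩
  rintro rfl
  exact surjHomCount_self_ne_zero B (by simpa using hsurj B)
end

section
/- Let σ be a finite relational signature, let B₁,…,B_n be pairwise non-isomorphic finite σ-structures, and let β₁,…,β_n be rational numbers. If for every finite σ-structure A it holds that Σ_{i=1}^n β_i · hom(A,B_i) = 0, then β₁ = ⋯ = β_n = 0. In other words, the functions hom(·,B), taken over a set of representatives of isomorphism classes of finite σ-structures, are linearly independent over ℚ. -/
variable {σ : Sig}

/-- The structure with empty universe and empty relations. -/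
def emptyStr (σ : Sig) : Str σ where
  carrier := Empty
  rel _ := ∅

theorem homCount_emptyStr (B : Str σ) : homCount (emptyStr σ) B = 1 := by
  unfold homCount
  rw [Nat.card_eq_one_iff_unique]
  refine ⟨⟨fun f g => Subtype.ext (funext fun x => Empty.elim x)⟩,
    ⟨⟨fun x => Empty.elim x, fun _ _ ht => ht.elim⟩⟩⟩

/-- Homomorphism counts turn disjoint unions into products. -/
theorem homCount_disjUnion (A₁ A₂ B : Str σ) :
    homCount (disjUnion A₁ A₂) B = homCount A₁ B * homCount A₂ B := by
  unfold homCount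
  rw [← Nat.card_prod]
  refine Nat.card_congr
    { toFun := fun h => (⟨h.1 ∘ Sum.inl, fun R t ht => h.2 R _ (Or.inl ⟨t, ht, rfl⟩)⟩,
        ⟨h.1 ∘ Sum.inr, fun R t ht => h.2 R _ (Or.inr ⟨t, ht, rfl⟩)⟩)
      invFun := fun p => ⟨Sum.elim p.1.1 p.2.1, ?_⟩
      left_inv := fun h => Subtype.ext (Sum.elim_comp_inl_inr h.1)
      right_inv := fun p => rfl }
  rintro R _ (⟨t, ht, rfl⟩ | ⟨t, ht, rfl⟩)
  · exact p.1.2 R t ht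
  · exact p.2.2 R t ht

/-- The quotient of a structure by an equivalence relation on its universe. -/
def quotientStr (A : Str σ) (θ : Setoid A.carrier) : Str σ where
  carrier := Quotient θ
  rel R := (fun t => Quotient.mk θ ∘ t) '' A.rel R

/-- The number of injective homomorphisms from `A` to `B`. -/
noncomputable def injHomCount (A B : Str σ) : ℕ :=
  Nat.card {h : A.carrier → B.carrier // IsHom A B h ∧ Function.Injective h}

/-- Homomorphisms with kernel `θ` correspond to injective homomorphisms from the quotient
by `θ`. -/
theorem card_hom_ker_eq (A B : Str σ) (θ : Setoid A.carrier) :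
    Nat.card {h : {h : A.carrier → B.carrier // IsHom A B h} // Setoid.ker h.1 = θ} =
      injHomCount (quotientStr A θ) B := by
  unfold injHomCount
  refine Nat.card_congr
    { toFun := fun h => ⟨Quotient.lift h.1.1 fun a b hab => ?_, ?_, ?_⟩
      invFun := fun g => ⟨⟨g.1 ∘ Quotient.mk θ, fun R t ht => g.2.1 R _ ⟨t, ht, rfl⟩⟩, ?_⟩
      left_inv := fun h => rfl
      right_inv := fun g => Subtype.ext (funext fun x => Quotient.inductionOn x fun _ => rfl) }
  · obtain ⟨h, rfl⟩ := h
    exact hab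
  · rintro R _ ⟨t, ht, rfl⟩
    exact h.1.2 R t ht
  · obtain ⟨h, rfl⟩ := h
    intro x y
    induction x using Quotient.inductionOn
    induction y using Quotient.inductionOn
    exact fun hxy => Quotient.sound hxy
  · ext a b
    exact g.2.2.eq_iff.trans Quotient.eq

theorem injHomCount_eq_card_ker_bot (A B : Str σ) :
    Nat.card {h : {h : A.carrier → B.carrier // IsHom A B h} // Setoid.ker h.1 = ⊥} =
      injHomCount A B := by
  unfold injHomCount
  refine Nat.card_congr
    ((Equiv.subtypeSubtypeEquivSubtypeInter _ (fun h => Setoid.ker h = ⊥)).trans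
      (Equiv.subtypeEquivRight fun h => ?_))
  rw [Setoid.injective_iff_ker_bot]

/-- Every homomorphism factors uniquely as a quotient map followed by an injective
homomorphism. -/
theorem homCount_eq_sum (A B : Str σ) [Fintype (Setoid A.carrier)]
    [DecidableEq (Setoid A.carrier)] :
    homCount A B = injHomCount A B +
      ∑ θ ∈ Finset.univ.erase ⊥, injHomCount (quotientStr A θ) B := by
  have h : homCount A B = ∑ θ : Setoid A.carrier,
      Nat.card {h : {h : A.carrier → B.carrier // IsHom A B h} // Setoid.ker h.1 = θ} := by
    rw [← Nat.card_sigma]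
    exact Nat.card_congr (Equiv.sigmaFiberEquiv _).symm
  rw [h, ← Finset.add_sum_erase _ _ (Finset.mem_univ ⊥), injHomCount_eq_card_ker_bot]
  simp only [card_hom_ker_eq]

theorem card_quotient_lt {α : Type*} [Finite α] {θ : Setoid α} (hθ : θ ≠ ⊥) :
    Nat.card (Quotient θ) < Nat.card α := by
  refine lt_of_le_of_ne (Nat.card_le_card_of_surjective _ Quotient.mk_surjective) fun hcard => ?_
  have hinj := (Nat.bijective_iff_surjective_and_card (Quotient.mk θ)).2
    ⟨Quotient.mk_surjective, hcard.symm⟩ |>.1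
  exact hθ (eq_bot_iff.2 fun a b hab => hinj (Quotient.sound hab))

/-- Homomorphism counts determine injective homomorphism counts. -/
theorem injHomCount_congr {B C : Str σ} (h : ∀ A, homCount A B = homCount A C)
    (A : Str σ) : injHomCount A B = injHomCount A C := by
  classical
  induction hn : Nat.card A.carrier using Nat.strong_induction_on generalizing A with
  | _ n ih =>
    have : Finite (Setoid A.carrier) :=
      Finite.of_injective (fun θ : Setoid A.carrier => θ.r) fun _ _ h => Setoid.ext fun a b =>
        iff_of_eq (congrFun (congrFun h a) b)
    have : Fintype (Setoid A.carrier) := Fintype.ofFinite _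
    have hA := h A
    rw [homCount_eq_sum, homCount_eq_sum] at hA
    rw [Finset.sum_congr rfl fun θ hθ => ih _
      (hn ▸ card_quotient_lt (Finset.ne_of_mem_erase hθ)) (quotientStr A θ) rfl] at hA
    exact Nat.add_right_cancel hA

theorem exists_injective_hom {B C : Str σ}
    (h : ∀ A, injHomCount A B = injHomCount A C) :
    ∃ f, IsHom B C f ∧ Function.Injective f := by
  have : Nonempty {f : B.carrier → B.carrier // IsHom B B f ∧ Function.Injective f} :=
    ⟨⟨id, fun _ _ ht => ht, Function.injective_id⟩⟩
  have hpos : 0 < injHomCount B C := h B ▸ Nat.card_pos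
  obtain ⟨f⟩ := (Nat.card_pos_iff.1 hpos).1
  exact ⟨f.1, f.2⟩

theorem ncard_rel_le {B C : Str σ} {f : B.carrier → C.carrier} (hf : IsHom B C f)
    (hinj : Function.Injective f) (R : σ.symb) : (B.rel R).ncard ≤ (C.rel R).ncard :=
  Set.ncard_le_ncard_of_injOn (fun t => f ∘ t) (hf R) hinj.comp_left.injOn

/-- Finite structures with injective homomorphisms in both directions are isomorphic. -/
theorem iso_of_injective_homs {B C : Str σ} {f : B.carrier → C.carrier}
    {g : C.carrier → B.carrier} (hf : IsHom B C f) (hfi : Function.Injective f)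
    (hg : IsHom C B g) (hgi : Function.Injective g) : Iso B C := by
  have hbij : Function.Bijective f := (Nat.bijective_iff_injective_and_card f).2
    ⟨hfi, (Nat.card_le_card_of_injective f hfi).antisymm (Nat.card_le_card_of_injective g hgi)⟩
  refine ⟨Equiv.ofBijective f hbij, fun R t => ⟨hf R t, fun ht => ?_⟩⟩
  have himage : (fun t => f ∘ t) '' B.rel R = C.rel R := by
    refine Set.eq_of_subset_of_ncard_le (Set.image_subset_iff.2 (hf R)) ?_
    rw [Set.ncard_image_of_injective _ hfi.comp_left]
    exact ncard_rel_le hg hgi R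
  rw [← himage] at ht
  exact (hfi.comp_left.mem_set_image).1 ht

/-- Homomorphism counts into a finite structure determine it up to isomorphism. -/
theorem iso_of_homCount_eq {B C : Str σ} (h : ∀ A, homCount A B = homCount A C) :
    Iso B C := by
  obtain ⟨f, hf, hfi⟩ := exists_injective_hom (injHomCount_congr h)
  obtain ⟨g, hg, hgi⟩ := exists_injective_hom (injHomCount_congr fun A => (h A).symm)
  exact iso_of_injective_homs hf hfi hg hgi

/-- The multiplicative extension of `hom(·, B)` to words of structures. -/
noncomputable def homChar (B : Str σ) : FreeMonoid (Str σ) →* ℚ :=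
  FreeMonoid.lift fun A => (homCount A B : ℚ)

/-- Every word of structures is represented by a single structure, its disjoint union. -/
theorem exists_homChar_eq (w : FreeMonoid (Str σ)) :
    ∃ A : Str σ, ∀ B, homChar B w = homCount A B := by
  induction w using FreeMonoid.inductionOn' with
  | one => exact ⟨emptyStr σ, fun B => by simp [homCount_emptyStr]⟩
  | of_mul A w ih =>
    obtain ⟨A', hA'⟩ := ih
    refine ⟨disjUnion A A', fun B => ?_⟩
    rw [map_mul, hA', homCount_disjUnion, Nat.cast_mul, homChar, FreeMonoid.lift_eval_of]

/-- the functions hom(·,B) over pairwise non-isomorphic templates are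
linearly independent over ℚ. -/
theorem stmt_8 (σ : Sig) (n : ℕ) (β : Fin n → ℚ) (Bs : Fin n → Str σ)
    (hiso : ∀ i j, i ≠ j → ¬ Iso (Bs i) (Bs j))
    (hzero : ∀ A : Str σ, ∑ i, β i * (homCount A (Bs i) : ℚ) = 0) :
    ∀ i, β i = 0 := by
  have hinj : Function.Injective fun i => homChar (Bs i) := by
    intro i j hij
    by_contra hne
    refine hiso i j hne (iso_of_homCount_eq fun A => ?_)
    have hA := DFunLike.congr_fun hij (FreeMonoid.of A)
    simp only [homChar, FreeMonoid.lift_eval_of] at hA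
    exact_mod_cast hA
  refine Fintype.linearIndependent_iff.1
    ((linearIndependent_monoidHom (FreeMonoid (Str σ)) ℚ).comp _ hinj) β (funext fun w => ?_)
  obtain ⟨A, hA⟩ := exists_homChar_eq w
  simpa [hA] using hzero A
end

section
/- Let σ be a finite relational signature. Suppose β₁,…,β_k and γ₁,…,γ_l are nonzero rational numbers, B₁,…,B_k are pairwise non-isomorphic finite σ-structures, C₁,…,C_l are pairwise non-isomorphic finite σ-structures, and for every finite σ-structure A it holds that Σ_{i=1}^k β_i · hom(A,B_i) = Σ_{j=1}^l γ_j · hom(A,C_j). Then k = l and there is a bijection π : {1,…,k} → {1,…,l} such that for each i, B_i is isomorphic to C_{π(i)} and β_i = γ_{π(i)}. In other words, the representation of a function as a finite linear combination of homomorphism-counting functions with nonzero coefficients and pairwise non-isomorphic targets is unique up to isomorphism and reordering. -/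
variable {σ : Sig}

namespace Str

/-- The quotient of a structure by an equivalence relation, with the image relations. -/
def quot (A : Str σ) (θ : Setoid A.carrier) : Str σ where
  carrier := Quotient θ
  rel R := (fun t => Quotient.mk θ ∘ t) '' A.rel R

/-- The structure with empty universe and empty relations. -/
def empty (σ : Sig) : Str σ where
  carrier := Empty
  rel _ := ∅

/-- The number of homomorphisms from `A` to `B` with kernel `θ`. -/
noncomputable def kerCount (A B : Str σ) (θ : Setoid A.carrier) : ℕ :=
  Nat.card {h : A.carrier → B.carrier // IsHom A B h ∧ Setoid.ker h = θ}

theorem isHom_quot_iff {A B : Str σ} {θ : Setoid A.carrier} {g : Quotient θ → B.carrier} :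
    IsHom (A.quot θ) B g ↔ IsHom A B (g ∘ Quotient.mk θ) :=
  ⟨fun hg R t ht => hg R _ ⟨t, ht, rfl⟩, by rintro hg R _ ⟨t, ht, rfl⟩; exact hg R t ht⟩

theorem ker_comp_mk_eq_iff {α β : Type*} {θ : Setoid α} {g : Quotient θ → β} :
    Setoid.ker (g ∘ Quotient.mk θ) = θ ↔ Setoid.ker g = ⊥ := by
  rw [Setoid.ker_eq_bot_iff]
  constructor
  · intro h x y
    induction x using Quotient.inductionOn
    induction y using Quotient.inductionOn
    intro hxy
    refine Quotient.sound ?_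
    change θ _ _
    rw [← h]
    exact hxy
  · intro h
    ext x y
    exact h.eq_iff.trans Quotient.eq

theorem kerCount_eq_kerCount_quot (A B : Str σ) (θ : Setoid A.carrier) :
    kerCount A B θ = kerCount (A.quot θ) B ⊥ := by
  refine (Nat.card_eq_of_bijective
    (fun g : {g : (A.quot θ).carrier → B.carrier // IsHom (A.quot θ) B g ∧ Setoid.ker g = ⊥} =>
      (⟨g.1 ∘ Quotient.mk θ, isHom_quot_iff.1 g.2.1, ker_comp_mk_eq_iff.2 g.2.2⟩ :
        {h : A.carrier → B.carrier // IsHom A B h ∧ Setoid.ker h = θ})) ⟨?_, ?_⟩).symm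
  · intro g g' h
    exact Subtype.ext (Quotient.mk_surjective.injective_comp_right (congrArg Subtype.val h))
  · rintro ⟨h, hh, hker⟩
    have hlift : ∀ a b, θ a b → h a = h b := fun a b hab => by
      rw [← hker] at hab
      exact hab
    exact ⟨⟨Quotient.lift h hlift, isHom_quot_iff.2 hh, ker_comp_mk_eq_iff.1 hker⟩, rfl⟩

theorem homCount_eq_sum_kerCount (A B : Str σ) [Fintype (Setoid A.carrier)] :
    homCount A B = ∑ θ, kerCount A B θ := by
  unfold homCount kerCount
  rw [← Nat.card_sigma]
  exact Nat.card_congr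
    { toFun := fun h => ⟨Setoid.ker h.1, h.1, h.2, rfl⟩
      invFun := fun p => ⟨p.2.1, p.2.2.1⟩
      left_inv := fun _ => rfl
      right_inv := by rintro ⟨_, h, hh, rfl⟩; rfl }

theorem card_quot_lt (A : Str σ) {θ : Setoid A.carrier} (hθ : θ ≠ ⊥) :
    Nat.card (A.quot θ).carrier < Nat.card A.carrier := by
  refine lt_of_le_of_ne (Nat.card_le_card_of_surjective _ Quotient.mk_surjective) fun h => hθ ?_
  have hinj : Function.Injective (Quotient.mk θ) :=
    ((Nat.bijective_iff_surjective_and_card _).2 ⟨Quotient.mk_surjective, h.symm⟩).1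
  rw [← Setoid.ker_eq_bot_iff] at hinj
  rw [← hinj]
  exact (Setoid.ker_mk_eq θ).symm

/-- The number of injective homomorphisms into a structure is determined by the homomorphism
counts into it. -/
theorem kerCount_bot_eq {B C : Str σ} (h : ∀ A, homCount A B = homCount A C) (A : Str σ) :
    kerCount A B ⊥ = kerCount A C ⊥ := by
  classical
  induction hn : Nat.card A.carrier using Nat.strong_induction_on generalizing A with
  | _ n ih =>
    subst hn
    have : Finite (Setoid A.carrier) :=
      Finite.of_injective (fun θ : Setoid A.carrier => (θ : A.carrier → A.carrier → Prop))
        fun _ _ hθ => Setoid.ext fun a b => iff_of_eq (congrFun₂ hθ a b)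
    have := Fintype.ofFinite (Setoid A.carrier)
    have hsum := h A
    rw [homCount_eq_sum_kerCount, homCount_eq_sum_kerCount,
      ← Finset.add_sum_erase _ _ (Finset.mem_univ ⊥),
      ← Finset.add_sum_erase _ (kerCount A C) (Finset.mem_univ ⊥),
      Finset.sum_congr rfl fun θ hθ => ?_] at hsum
    · exact Nat.add_right_cancel hsum
    · rw [kerCount_eq_kerCount_quot, kerCount_eq_kerCount_quot A C]
      exact ih _ (A.card_quot_lt (Finset.ne_of_mem_erase hθ)) _ rfl

theorem exists_injective_isHom {B C : Str σ} (h : ∀ A, homCount A B = homCount A C) :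
    ∃ f, IsHom B C f ∧ Function.Injective f := by
  have hne : kerCount B C ⊥ ≠ 0 := by
    rw [← kerCount_bot_eq h]
    have : Nonempty {g : B.carrier → B.carrier // IsHom B B g ∧ Setoid.ker g = ⊥} :=
      ⟨⟨id, fun _ _ ht => ht, Setoid.ker_eq_bot_iff.2 Function.injective_id⟩⟩
    exact Nat.card_pos.ne'
  obtain ⟨⟨f, hf, hker⟩⟩ := (Nat.card_ne_zero.1 hne).1
  exact ⟨f, hf, Setoid.ker_eq_bot_iff.1 hker⟩

theorem ncard_rel_le {B C : Str σ} {f : B.carrier → C.carrier} (hf : IsHom B C f)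
    (hinj : Function.Injective f) (R : σ.symb) : (B.rel R).ncard ≤ (C.rel R).ncard :=
  Set.ncard_le_ncard_of_injOn (fun t => f ∘ t) (hf R) hinj.comp_left.injOn

theorem iso_of_injective {B C : Str σ} {f : B.carrier → C.carrier} {g : C.carrier → B.carrier}
    (hf : IsHom B C f) (hfinj : Function.Injective f)
    (hg : IsHom C B g) (hginj : Function.Injective g) : Iso B C := by
  have hbij : Function.Bijective f :=
    (Nat.bijective_iff_injective_and_card f).2 ⟨hfinj, le_antisymm
      (Nat.card_le_card_of_injective f hfinj) (Nat.card_le_card_of_injective g hginj)⟩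
  refine ⟨Equiv.ofBijective f hbij, fun R t => ⟨hf R t, fun ht => ?_⟩⟩
  have himage : (fun t => f ∘ t) '' B.rel R = C.rel R := by
    refine Set.eq_of_subset_of_ncard_le (Set.image_subset_iff.2 (hf R)) ?_
    rw [Set.ncard_image_of_injective _ hfinj.comp_left]
    exact ncard_rel_le hg hginj R
  rw [← himage] at ht
  obtain ⟨s, hs, hst⟩ := ht
  rwa [← hfinj.comp_left hst]

/-- Structures are determined up to isomorphism by the homomorphism counts into them. -/
theorem iso_of_homCount_eq {B C : Str σ} (h : ∀ A, homCount A B = homCount A C) : Iso B C := by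
  obtain ⟨f, hf, hfinj⟩ := exists_injective_isHom h
  obtain ⟨g, hg, hginj⟩ := exists_injective_isHom fun A => (h A).symm
  exact iso_of_injective hf hfinj hg hginj

theorem homCount_empty (B : Str σ) : homCount (empty σ) B = 1 := by
  refine Nat.card_eq_one_iff_unique.2 ⟨⟨fun f g => Subtype.ext (funext fun x => ?_)⟩,
    ⟨⟨fun x => (x : Empty).elim, fun _ _ ht => ht.elim⟩⟩⟩
  exact (x : Empty).elim

theorem isHom_disjUnion_iff {A₁ A₂ B : Str σ} {h : A₁.carrier ⊕ A₂.carrier → B.carrier} :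
    IsHom (disjUnion A₁ A₂) B h ↔ IsHom A₁ B (h ∘ Sum.inl) ∧ IsHom A₂ B (h ∘ Sum.inr) := by
  refine ⟨fun hh => ⟨fun R t ht => hh R _ (Or.inl ⟨t, ht, rfl⟩),
    fun R t ht => hh R _ (Or.inr ⟨t, ht, rfl⟩)⟩, ?_⟩
  rintro ⟨h₁, h₂⟩ R _ (⟨t, ht, rfl⟩ | ⟨t, ht, rfl⟩)
  · exact h₁ R t ht
  · exact h₂ R t ht

theorem homCount_disjUnion (A₁ A₂ B : Str σ) :
    homCount (disjUnion A₁ A₂) B = homCount A₁ B * homCount A₂ B := by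
  unfold homCount
  rw [← Nat.card_prod]
  exact Nat.card_congr (((Equiv.sumArrowEquivProdArrow _ _ _).subtypeEquiv
    (q := fun p => IsHom A₁ B p.1 ∧ IsHom A₂ B p.2) fun _ => isHom_disjUnion_iff).trans
      Equiv.subtypeProdEquivProd)

/-- Homomorphism counts into `B`, extended multiplicatively to formal disjoint unions. -/
noncomputable def homChar (B : Str σ) : FreeMonoid (Str σ) →* ℚ :=
  FreeMonoid.lift fun A => (homCount A B : ℚ)

theorem exists_homChar_eq (w : FreeMonoid (Str σ)) :
    ∃ A : Str σ, ∀ B : Str σ, homChar B w = homCount A B := by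
  induction w using FreeMonoid.inductionOn' with
  | one => exact ⟨empty σ, fun B => by simp [homCount_empty]⟩
  | of_mul A w ih =>
    obtain ⟨A', hA'⟩ := ih
    exact ⟨disjUnion A A', fun B => by simp [homCount_disjUnion, ← hA', homChar]⟩

theorem iso_of_homChar_eq {B C : Str σ} (h : homChar B = homChar C) : Iso B C :=
  iso_of_homCount_eq fun A => by
    simpa [homChar] using DFunLike.congr_fun h (FreeMonoid.of A)

end Str

/-- In a linear combination over injectively indexed points, equality of the induced finitely
supported functions matches the points together with their coefficients. -/
theorem exists_eq_of_mapDomain_eq {ι κ α M : Type*} [AddCommMonoid M] {b : ι → α} {c : κ → α}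
    (hb : Function.Injective b) (hc : Function.Injective c) {β : ι →₀ M} {γ : κ →₀ M}
    (h : β.mapDomain b = γ.mapDomain c) {i : ι} (hi : β i ≠ 0) :
    ∃ j, b i = c j ∧ β i = γ j := by
  have hval : γ.mapDomain c (b i) = β i := by rw [← h, Finsupp.mapDomain_apply hb]
  by_cases hmem : b i ∈ Set.range c
  · obtain ⟨j, hj⟩ := hmem
    exact ⟨j, hj.symm, by rw [← hval, ← hj, Finsupp.mapDomain_apply hc]⟩
  · exact (hi (by rw [← hval, Finsupp.mapDomain_of_notMem_range _ _ hmem])).elim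

/-- uniqueness of the representation of a function as a linear
combination of homomorphism-counting functions with nonzero coefficients and
pairwise non-isomorphic targets. -/
theorem stmt_12 (σ : Sig) (k l : ℕ) (β : Fin k → ℚ) (γ : Fin l → ℚ)
    (Bs : Fin k → Str σ) (Cs : Fin l → Str σ)
    (hβ : ∀ i, β i ≠ 0) (hγ : ∀ j, γ j ≠ 0)
    (hB : ∀ i j, i ≠ j → ¬ Iso (Bs i) (Bs j))
    (hC : ∀ i j, i ≠ j → ¬ Iso (Cs i) (Cs j))
    (heq : ∀ A : Str σ,
      ∑ i, β i * (homCount A (Bs i) : ℚ) = ∑ j, γ j * (homCount A (Cs j) : ℚ)) :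
    k = l ∧ ∃ π : Fin k ≃ Fin l, ∀ i, Iso (Bs i) (Cs (π i)) ∧ β i = γ (π i) := by
  have hBinj : Function.Injective (Str.homChar ∘ Bs) := fun i j hij =>
    by_contra fun hne => hB i j hne (Str.iso_of_homChar_eq hij)
  have hCinj : Function.Injective (Str.homChar ∘ Cs) := fun i j hij =>
    by_contra fun hne => hC i j hne (Str.iso_of_homChar_eq hij)
  have hmap : (Finsupp.equivFunOnFinite.symm β).mapDomain (Str.homChar ∘ Bs) =
      (Finsupp.equivFunOnFinite.symm γ).mapDomain (Str.homChar ∘ Cs) := by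
    refine linearIndependent_monoidHom (FreeMonoid (Str σ)) ℚ ?_
    rw [Finsupp.linearCombination_mapDomain, Finsupp.linearCombination_mapDomain,
      Finsupp.linearCombination_apply, Finsupp.linearCombination_apply,
      Finsupp.sum_fintype _ _ (by simp), Finsupp.sum_fintype _ _ (by simp)]
    funext w
    obtain ⟨A, hA⟩ := Str.exists_homChar_eq w
    simpa [hA] using heq A
  choose π hπ using fun i => exists_eq_of_mapDomain_eq hBinj hCinj hmap (hβ i)
  choose ρ hρ using fun j => exists_eq_of_mapDomain_eq hCinj hBinj hmap.symm (hγ j)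
  let e : Fin k ≃ Fin l :=
    { toFun := π
      invFun := ρ
      left_inv := fun i => hBinj ((hπ i).1.trans (hρ (π i)).1).symm
      right_inv := fun j => hCinj ((hρ j).1.trans (hπ (ρ j)).1).symm }
  exact ⟨Fin.equiv_iff_eq.1 ⟨e⟩, e, fun i => ⟨Str.iso_of_homChar_eq (hπ i).1, (hπ i).2⟩⟩
end
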